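/- Let 𝓓 = (Ω, 𝓑) be a supersimple 2-(n,4,λ) design and ∞ ∈ Ω. If n > 4λ + 1, then the hole stabilizer G = π_∞(𝓓) acts transitively on Ω \ {∞}. -/

import Mathlib

open Equiv

variable {Ω : Type*} [DecidableEq Ω] [Fintype Ω]

/-- Two points of a 4-hypergraph are collinear if they are equal or some line contains both. -/
def HGCollinear (B : Finset (Finset Ω)) (x y : Ω) : Prop :=
  x = y ∨ ∃ b ∈ B, x ∈ b ∧ y ∈ b

/-- A 4-hypergraph is pliable if any two lines sharing three pairwise distinct points are equal. -/
def HGPliable (B : Finset (Finset Ω)) : Prop :=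
  ∀ b₁ ∈ B, ∀ b₂ ∈ B, ∀ p q r : Ω, p ≠ q → p ≠ r → q ≠ r →
    p ∈ b₁ → q ∈ b₁ → r ∈ b₁ → p ∈ b₂ → q ∈ b₂ → r ∈ b₂ → b₁ = b₂

/-- `g` is the elementary move `[x,y]`: it interchanges `x` and `y`, interchanges the
remaining two points of every line through `x` and `y`, and fixes everything else.
For `x = y` it is the identity. -/
def IsElemMove (B : Finset (Finset Ω)) (x y : Ω) (g : Equiv.Perm Ω) : Prop :=
  (x = y ∧ g = 1) ∨
  (x ≠ y ∧ (∃ b ∈ B, x ∈ b ∧ y ∈ b) ∧ g x = y ∧ g y = x ∧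
    ∀ z : Ω, z ≠ x → z ≠ y →
      ((∀ b ∈ B, ¬(x ∈ b ∧ y ∈ b ∧ z ∈ b)) → g z = z) ∧
      (∀ b ∈ B, x ∈ b → y ∈ b → z ∈ b →
        ∀ w ∈ b, w ≠ x → w ≠ y → w ≠ z → g z = w))

/-- `g` is the move sequence `[a₀,…,a_k]` recorded by the list
(elementary moves applied left to right). -/
def IsMoveSeq (B : Finset (Finset Ω)) : List Ω → Equiv.Perm Ω → Prop
  | [], _ => False
  | [_], g => g = 1
  | a :: b :: l, g => ∃ e h : Equiv.Perm Ω,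
      IsElemMove B a b e ∧ IsMoveSeq B (b :: l) h ∧ g = h * e

/-- The puzzle set `𝓛_𝓓` of all move sequences. -/
def puzzleSet (B : Finset (Finset Ω)) : Set (Equiv.Perm Ω) :=
  { g | ∃ l : List Ω, IsMoveSeq B l g }

/-- The hole stabiliser `π_x(𝓓)`: all closed move sequences starting and ending at `x`. -/
def holeStab (B : Finset (Finset Ω)) (x : Ω) : Set (Equiv.Perm Ω) :=
  { g | ∃ l : List Ω, l.head? = some x ∧ l.getLast? = some x ∧ IsMoveSeq B l g }

/-- `(Ω, B)` is a 2-(n,4,λ) design: lines have four points and every pair of distinct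
points lies in exactly `lam` lines. -/
def IsTwoDesign (B : Finset (Finset Ω)) (lam : ℕ) : Prop :=
  (∀ b ∈ B, b.card = 4) ∧
  ∀ p q : Ω, p ≠ q → (B.filter fun b => p ∈ b ∧ q ∈ b).card = lam

/-- Supersimple: any two distinct lines meet in at most two points. -/
def HGSupersimple (B : Finset (Finset Ω)) : Prop :=
  ∀ b₁ ∈ B, ∀ b₂ ∈ B, b₁ ≠ b₂ → (b₁ ∩ b₂).card ≤ 2

/-- `x ∈ overline{a,c}`: `x` is `a`, `c`, or lies on a line containing both `a` and `c`. -/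
def HGLineClosure (B : Finset (Finset Ω)) (a c x : Ω) : Prop :=
  x = a ∨ x = c ∨ ∃ b ∈ B, a ∈ b ∧ c ∈ b ∧ x ∈ b

/-- A system of imprimitivity for the hole stabiliser `π_x` acting on `Ω \ {x}`,
with `ℓ` blocks each of size `k`. -/
def IsHoleBlockSystem (B : Finset (Finset Ω)) (x : Ω) (P : Finset (Finset Ω))
    (k ℓ : ℕ) : Prop :=
  P.card = ℓ ∧ 1 < k ∧ 1 < ℓ ∧ (∀ Δ ∈ P, Δ.card = k) ∧
  (∀ a : Ω, a ≠ x → ∃! Δ : Finset Ω, Δ ∈ P ∧ a ∈ Δ) ∧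
  (∀ Δ ∈ P, x ∉ Δ) ∧
  (∀ g ∈ holeStab B x, ∀ Δ ∈ P, Δ.image (⇑g) ∈ P)

/-- In a supersimple design with `0 < lam`, the elementary move `[x,y]` exists for all `x ≠ y`. -/
theorem exists_isElemMove {Ω : Type*} [DecidableEq Ω] {B : Finset (Finset Ω)} {lam : ℕ}
    (hlam : 0 < lam) (hdes : IsTwoDesign B lam) (hss : HGSupersimple B) {x y : Ω}
    (hxy : x ≠ y) : ∃ g : Equiv.Perm Ω, IsElemMove B x y g := by
  have huniq : ∀ b₁ ∈ B, ∀ b₂ ∈ B, ∀ z, z ≠ x → z ≠ y → x ∈ b₁ → y ∈ b₁ → z ∈ b₁ →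
      x ∈ b₂ → y ∈ b₂ → z ∈ b₂ → b₁ = b₂ := by
    intro b₁ h₁ b₂ h₂ z hzx hzy _ _ _ _ _ _
    by_contra hne
    have hsub : ({x, y, z} : Finset Ω) ⊆ b₁ ∩ b₂ := by
      intro t ht
      simp only [Finset.mem_insert, Finset.mem_singleton] at ht
      rcases ht with rfl | rfl | rfl <;> simp_all
    have hcard : ({x, y, z} : Finset Ω).card = 3 :=
      Finset.card_eq_three.2 ⟨x, y, z, hxy, hzx.symm, hzy.symm, rfl⟩
    have := Finset.card_le_card hsub
    have := hss b₁ h₁ b₂ h₂ hne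
    omega
  have hfour : ∀ b ∈ B, ∀ z, z ≠ x → z ≠ y → x ∈ b → y ∈ b → z ∈ b →
      ∃ w, b \ {x, y, z} = {w} := by
    intro b hb z hzx hzy _ _ _
    have hsub : ({x, y, z} : Finset Ω) ⊆ b := by
      intro t ht
      simp only [Finset.mem_insert, Finset.mem_singleton] at ht
      rcases ht with rfl | rfl | rfl <;> assumption
    have hcard : ({x, y, z} : Finset Ω).card = 3 :=
      Finset.card_eq_three.2 ⟨x, y, z, hxy, hzx.symm, hzy.symm, rfl⟩
    have hsdiff := Finset.card_sdiff_of_subset hsub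
    rw [hdes.1 b hb, hcard] at hsdiff
    exact Finset.card_eq_one.1 hsdiff
  have hpartner : ∀ b ∈ B, ∀ z w w', z ≠ x → z ≠ y → x ∈ b → y ∈ b → z ∈ b →
      w ∈ b → w ≠ x → w ≠ y → w ≠ z → w' ∈ b → w' ≠ x → w' ≠ y → w' ≠ z → w = w' := by
    intro b hb z w w' hzx hzy hx hy hz hw hwx hwy hwz hw' hwx' hwy' hwz'
    obtain ⟨v, hv⟩ := hfour b hb z hzx hzy hx hy hz
    have h₁ : w ∈ b \ {x, y, z} := by simp [hw, hwx, hwy, hwz]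
    have h₂ : w' ∈ b \ {x, y, z} := by simp [hw', hwx', hwy', hwz']
    rw [hv, Finset.mem_singleton] at h₁ h₂
    rw [h₁, h₂]
  let R : Ω → Ω → Prop := fun z w => (z = x ∧ w = y) ∨ (z = y ∧ w = x) ∨
    (z ≠ x ∧ z ≠ y ∧ w ≠ x ∧ w ≠ y ∧
      ((∃ b ∈ B, x ∈ b ∧ y ∈ b ∧ z ∈ b ∧ w ∈ b ∧ w ≠ z) ∨
        (w = z ∧ ∀ b ∈ B, ¬(x ∈ b ∧ y ∈ b ∧ z ∈ b))))
  have hR : ∀ z, ∃ w, R z w := by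
    intro z
    by_cases hzx : z = x
    · exact ⟨y, Or.inl ⟨hzx, rfl⟩⟩
    by_cases hzy : z = y
    · exact ⟨x, Or.inr (Or.inl ⟨hzy, rfl⟩)⟩
    by_cases hline : ∃ b ∈ B, x ∈ b ∧ y ∈ b ∧ z ∈ b
    · obtain ⟨b, hb, hx, hy, hz⟩ := hline
      obtain ⟨w, hw⟩ := hfour b hb z hzx hzy hx hy hz
      have hmem : w ∈ b \ {x, y, z} := by simp [hw]
      simp only [Finset.mem_sdiff, Finset.mem_insert, Finset.mem_singleton, not_or] at hmem
      exact ⟨w, Or.inr (Or.inr ⟨hzx, hzy, hmem.2.1, hmem.2.2.1,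
        Or.inl ⟨b, hb, hx, hy, hz, hmem.1, hmem.2.2.2⟩⟩)⟩
    · push Not at hline
      exact ⟨z, Or.inr (Or.inr ⟨hzx, hzy, hzx, hzy, Or.inr ⟨rfl, by
        rintro b hb ⟨h₁, h₂, h₃⟩
        exact hline b hb h₁ h₂ h₃⟩⟩)⟩
  have hsymm : ∀ z w, R z w → R w z := by
    rintro z w (h | h | ⟨h₁, h₂, h₃, h₄, ⟨b, hb, hx, hy, hz, hw, hwz⟩ | ⟨rfl, h⟩⟩)
    · exact Or.inr (Or.inl h.symm)
    · exact Or.inl h.symm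
    · exact Or.inr (Or.inr ⟨h₃, h₄, h₁, h₂, Or.inl ⟨b, hb, hx, hy, hw, hz, hwz.symm⟩⟩)
    · exact Or.inr (Or.inr ⟨h₃, h₄, h₁, h₂, Or.inr ⟨rfl, h⟩⟩)
  have hfun : ∀ z w w', R z w → R z w' → w = w' := by
    rintro z w w' (⟨h₁, h₂⟩ | ⟨h₁, h₂⟩ | ⟨h₁, h₂, h₃, h₄, h⟩)
      (⟨h₅, h₆⟩ | ⟨h₅, h₆⟩ | ⟨h₅, h₆, h₇, h₈, h'⟩)
    · exact h₂.trans h₆.symm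
    · exact absurd (h₁.symm.trans h₅) hxy
    · exact absurd h₁ h₅
    · exact absurd (h₅.symm.trans h₁) hxy
    · exact h₂.trans h₆.symm
    · exact absurd h₁ h₆
    · exact absurd h₅ h₁
    · exact absurd h₅ h₂
    · rcases h with ⟨b, hb, hx, hy, hz, hw, hwz⟩ | ⟨rfl, h⟩ <;>
        rcases h' with ⟨b', hb', hx', hy', hz', hw', hwz'⟩ | ⟨rfl, h'⟩
      · obtain rfl := huniq b hb b' hb' z h₁ h₂ hx hy hz hx' hy' hz'
        exact hpartner b hb z w w' h₁ h₂ hx hy hz hw h₃ h₄ hwz hw' h₇ h₈ hwz'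
      · exact absurd ⟨hx, hy, hz⟩ (h' b hb)
      · exact absurd ⟨hx', hy', hz'⟩ (h b' hb')
      · rfl
  choose f hf using hR
  have hinv : Function.Involutive f := fun z => hfun _ _ _ (hf (f z)) (hsymm _ _ (hf z))
  have hval : ∀ z w, R z w → hinv.toPerm f z = w := fun z w h => hfun _ _ _ (hf z) h
  refine ⟨hinv.toPerm f, Or.inr ⟨hxy, ?_, hval _ _ (Or.inl ⟨rfl, rfl⟩),
    hval _ _ (Or.inr (Or.inl ⟨rfl, rfl⟩)), fun z hzx hzy => ⟨fun h => ?_, ?_⟩⟩⟩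
  · have hpos : 0 < (B.filter fun b => x ∈ b ∧ y ∈ b).card := by
      rw [hdes.2 x y hxy]
      exact hlam
    obtain ⟨b, hb⟩ := Finset.card_pos.1 hpos
    exact ⟨b, Finset.mem_filter.1 hb⟩
  · exact hval _ _ (Or.inr (Or.inr ⟨hzx, hzy, hzx, hzy, Or.inr ⟨rfl, h⟩⟩))
  · intro b hb hx hy hz w hw hwx hwy hwz
    exact hval _ _ (Or.inr (Or.inr ⟨hzx, hzy, hwx, hwy, Or.inl ⟨b, hb, hx, hy, hz, hw, hwz⟩⟩))

theorem IsElemMove.apply_right {Ω : Type*} {B : Finset (Finset Ω)} {x y : Ω}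
    {g : Equiv.Perm Ω} (h : IsElemMove B x y g) : g y = x := by
  rcases h with ⟨rfl, rfl⟩ | h
  · rfl
  · exact h.2.2.2.1

theorem IsElemMove.apply_of_not_line {Ω : Type*} {B : Finset (Finset Ω)} {x y z : Ω}
    {g : Equiv.Perm Ω} (h : IsElemMove B x y g) (hx : z ≠ x) (hy : z ≠ y)
    (hz : ∀ b ∈ B, ¬(x ∈ b ∧ y ∈ b ∧ z ∈ b)) : g z = z := by
  rcases h with ⟨rfl, rfl⟩ | h
  · rfl
  · exact (h.2.2.2.2 z hx hy).1 hz

/-- The points other than `x` and `a` lying on a line through `x` and `a`. -/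
def lineNeighbors {Ω : Type*} [DecidableEq Ω] (B : Finset (Finset Ω)) (x a : Ω) : Finset Ω :=
  (B.filter fun b => x ∈ b ∧ a ∈ b).biUnion fun b => b \ {x, a}

theorem mem_lineNeighbors {Ω : Type*} [DecidableEq Ω] {B : Finset (Finset Ω)} {x a c : Ω} :
    c ∈ lineNeighbors B x a ↔ c ≠ x ∧ c ≠ a ∧ ∃ b ∈ B, x ∈ b ∧ a ∈ b ∧ c ∈ b := by
  simp only [lineNeighbors, Finset.mem_biUnion, Finset.mem_filter, Finset.mem_sdiff,
    Finset.mem_insert, Finset.mem_singleton]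
  constructor
  · rintro ⟨b, ⟨hb, hx, ha⟩, hc, hne⟩
    exact ⟨fun h => hne (Or.inl h), fun h => hne (Or.inr h), b, hb, hx, ha, hc⟩
  · rintro ⟨hcx, hca, b, hb, hx, ha, hc⟩
    exact ⟨b, ⟨hb, hx, ha⟩, hc, fun h => h.elim hcx hca⟩

theorem card_lineNeighbors_le {Ω : Type*} [DecidableEq Ω] {B : Finset (Finset Ω)} {lam : ℕ}
    (hdes : IsTwoDesign B lam) {x a : Ω} (hax : a ≠ x) :
    (lineNeighbors B x a).card ≤ lam * 2 := by
  rw [← hdes.2 x a hax.symm]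
  refine Finset.card_biUnion_le_card_mul _ _ _ fun b hb => ?_
  obtain ⟨hb, hx, ha⟩ := Finset.mem_filter.1 hb
  have hsub : ({x, a} : Finset Ω) ⊆ b := by simp [Finset.insert_subset_iff, hx, ha]
  rw [Finset.card_sdiff_of_subset hsub, hdes.1 b hb, Finset.card_pair hax.symm]

/-- (Lemma 5.1) If `n > 4λ + 1` then the hole stabilizer acts
transitively on `Ω \ {∞}`. -/
theorem stmt7 (B : Finset (Finset Ω)) (n lam : ℕ) (hn : Fintype.card Ω = n)
    (hlam : 0 < lam) (hdes : IsTwoDesign B lam) (hss : HGSupersimple B)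
    (hbig : 4 * lam + 1 < n) (x : Ω) :
    ∀ a b : Ω, a ≠ x → b ≠ x → ∃ g ∈ holeStab B x, g a = b := by
  intro a b hax hbx
  by_cases hab : a = b
  · exact ⟨1, ⟨[x], rfl, rfl, rfl⟩, hab⟩
  have hfix : ∀ {c d : Ω} {g : Equiv.Perm Ω}, c ≠ x → d ≠ x → c ≠ d →
      c ∉ lineNeighbors B x d → IsElemMove B d c g → g x = x := by
    intro c d g hc hd hcd hmem hg
    refine hg.apply_of_not_line hd.symm hc.symm fun l hl h => hmem ?_
    exact mem_lineNeighbors.2 ⟨hc, hcd, l, hl, h.2.2, h.1, h.2.1⟩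
  obtain ⟨e₁, h₁⟩ := exists_isElemMove hlam hdes hss hax.symm
  obtain ⟨e₄, h₄⟩ := exists_isElemMove hlam hdes hss hbx
  by_cases hba : b ∈ lineNeighbors B x a
  · have hab' : a ∈ lineNeighbors B x b := by
      obtain ⟨_, _, l, hl, hx, ha, hb⟩ := mem_lineNeighbors.1 hba
      exact mem_lineNeighbors.2 ⟨hax, hab, l, hl, hx, hb, ha⟩
    have hcard : (insert x (lineNeighbors B x a ∪ lineNeighbors B x b)).card < Fintype.card Ω := by
      have := Finset.card_insert_le x (lineNeighbors B x a ∪ lineNeighbors B x b)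
      have := Finset.card_union_le (lineNeighbors B x a) (lineNeighbors B x b)
      have := card_lineNeighbors_le hdes hax
      have := card_lineNeighbors_le hdes hbx
      omega
    obtain ⟨c, -, hc⟩ := Finset.exists_mem_notMem_of_card_lt_card hcard
    simp only [Finset.mem_insert, Finset.mem_union, not_or] at hc
    obtain ⟨hcx, hca, hcb⟩ := hc
    have hne_a : c ≠ a := fun h => hcb (h ▸ hab')
    have hne_b : c ≠ b := fun h => hca (h ▸ hba)
    have hbc : b ∉ lineNeighbors B x c := fun h => by
      obtain ⟨_, _, l, hl, hx, hc, hb⟩ := mem_lineNeighbors.1 h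
      exact hcb (mem_lineNeighbors.2 ⟨hcx, hne_b, l, hl, hx, hb, hc⟩)
    obtain ⟨e₂, h₂⟩ := exists_isElemMove hlam hdes hss hne_a.symm
    obtain ⟨e₃, h₃⟩ := exists_isElemMove hlam hdes hss hne_b
    refine ⟨(((1 * e₄) * e₃) * e₂) * e₁, ⟨[x, a, c, b, x], rfl, rfl,
      e₁, _, h₁, ⟨e₂, _, h₂, ⟨e₃, _, h₃, ⟨e₄, 1, h₄, rfl, rfl⟩, rfl⟩, rfl⟩, rfl⟩, ?_⟩
    simp [Equiv.Perm.mul_apply, h₁.apply_right, hfix hcx hax hne_a hca h₂,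
      hfix hbx hcx hne_b.symm hbc h₃, h₄.apply_right]
  · obtain ⟨e₂, h₂⟩ := exists_isElemMove hlam hdes hss hab
    refine ⟨((1 * e₄) * e₂) * e₁, ⟨[x, a, b, x], rfl, rfl,
      e₁, _, h₁, ⟨e₂, _, h₂, ⟨e₄, 1, h₄, rfl, rfl⟩, rfl⟩, rfl⟩, ?_⟩
    simp [Equiv.Perm.mul_apply, h₁.apply_right, hfix hbx hax (Ne.symm hab) hba h₂,
      h₄.apply_right]
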